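/- arXiv:1404.1467 — 5 statements merged into one kernel-verified Lean document; each statement's English description precedes it below -/
import Mathlib

section
/- Let t1(x) = min(K1, max(0, F1(x, 0))) be the restriction of T to the x1-axis, where 0 < K1 ≤ N1. Then for every x0 ∈ (0, K1], the orbit defined by x_{n+1} = t1(x_n) with initial value x0 is nondecreasing, stays in (0, K1], and converges to K1. Consequently every point (x0, 0) on the x1-axis with 0 < x0 ≤ K1 converges under iteration of T to the segregation fixed point (K1, 0). -/
/-- On the invariant `x1`-axis the restriction `t1` of `T` generates,
from any initial value `x0 ∈ (0, K1]`, a nondecreasing orbit staying in `(0, K1]`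
which converges to `K1`; consequently every point `(x0, 0)` with `0 < x0 ≤ K1`
converges under iteration of `T` to the segregation fixed point `(K1, 0)`. -/
theorem segregation_axis_orbit_converges
    (γ1 γ2 τ1 τ2 N1 N2 K1 K2 : ℝ)
    (hγ1 : 0 < γ1) (hγ2 : 0 < γ2) (hτ1 : 0 < τ1) (hτ2 : 0 < τ2)
    (hN1 : 0 < N1) (hN2 : 0 < N2)
    (hK1 : 0 < K1) (hK1N : K1 ≤ N1) (hK2 : 0 < K2) (hK2N : K2 ≤ N2)
    (F1 F2 : ℝ → ℝ → ℝ)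
    (hF1 : ∀ x1 x2, F1 x1 x2 = x1 * (1 - γ1 * x2 + γ1 * τ1 * x1 * (1 - x1 / N1)))
    (hF2 : ∀ x1 x2, F2 x1 x2 = x2 * (1 - γ2 * x1 + γ2 * τ2 * x2 * (1 - x2 / N2)))
    (T : ℝ × ℝ → ℝ × ℝ)
    (hT : ∀ p : ℝ × ℝ, T p = (min K1 (max 0 (F1 p.1 p.2)), min K2 (max 0 (F2 p.1 p.2))))
    (t1 : ℝ → ℝ)
    (ht1 : ∀ x, t1 x = min K1 (max 0 (F1 x 0))) :
    ∀ x0 : ℝ, 0 < x0 → x0 ≤ K1 →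
      Monotone (fun n => t1^[n] x0) ∧
      (∀ n : ℕ, t1^[n] x0 ∈ Set.Ioc (0 : ℝ) K1) ∧
      Filter.Tendsto (fun n => t1^[n] x0) Filter.atTop (nhds K1) ∧
      Filter.Tendsto (fun n => T^[n] (x0, 0)) Filter.atTop (nhds (K1, 0)) := by
  intro x0 hx0 hx0K
  have hF : ∀ x, 0 ≤ x → x ≤ K1 → x ≤ F1 x 0 := by
    intro x h0 hK
    have h1 : 0 ≤ 1 - x / N1 := by
      rw [sub_nonneg, div_le_one hN1]
      linarith
    have h2 : 0 ≤ x * (γ1 * τ1 * x * (1 - x / N1)) := by positivity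
    rw [hF1]
    linarith
  have hstep : ∀ x, 0 ≤ x → x ≤ K1 → x ≤ t1 x := by
    intro x h0 hK
    rw [ht1]
    exact le_min hK (le_max_of_le_right (hF x h0 hK))
  have hmem : ∀ n : ℕ, t1^[n] x0 ∈ Set.Ioc (0 : ℝ) K1 := by
    intro n
    induction n with
    | zero => exact ⟨hx0, hx0K⟩
    | succ k ih =>
      rw [Function.iterate_succ_apply']
      refine ⟨lt_of_lt_of_le ih.1 (hstep _ ih.1.le ih.2), ?_⟩
      rw [ht1]
      exact min_le_left _ _
  have hmono : Monotone (fun n => t1^[n] x0) := by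
    apply monotone_nat_of_le_succ
    intro n
    show t1^[n] x0 ≤ t1^[n+1] x0
    rw [Function.iterate_succ_apply']
    exact hstep _ (hmem n).1.le (hmem n).2
  have hcont : Continuous t1 := by
    have : t1 = fun x => min K1 (max 0
        (x * (1 - γ1 * 0 + γ1 * τ1 * x * (1 - x / N1)))) := by
      funext x
      rw [ht1, hF1]
    rw [this]
    fun_prop
  have hbdd : BddAbove (Set.range (fun n => t1^[n] x0)) := by
    refine ⟨K1, ?_⟩
    rintro _ ⟨n, rfl⟩
    exact (hmem n).2
  have hlim : Filter.Tendsto (fun n => t1^[n] x0) Filter.atTop (nhds K1) := by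
    have hL := tendsto_atTop_ciSup hmono hbdd
    set L := ⨆ n, t1^[n] x0 with hLdef
    have hfix : t1 L = L := isFixedPt_of_tendsto_iterate hL hcont.continuousAt
    have hL0 : x0 ≤ L := hmono.ge_of_tendsto hL 0
    have hLK : L ≤ K1 := le_of_tendsto' hL (fun n => (hmem n).2)
    have hLeq : L = K1 := by
      by_contra hne
      have hlt : L < K1 := lt_of_le_of_ne hLK hne
      have hLpos : 0 < L := by linarith
      have h1 : 0 < 1 - L / N1 := by
        rw [sub_pos, div_lt_one hN1]
        linarith
      have h2 : 0 < L * (γ1 * τ1 * L * (1 - L / N1)) := by positivity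
      have h3 : L < F1 L 0 := by
        rw [hF1]
        linarith
      have h4 : L < t1 L := by
        rw [ht1]
        exact lt_min hlt (lt_max_of_lt_right h3)
      linarith
    rwa [hLeq] at hL
  refine ⟨hmono, hmem, hlim, ?_⟩
  have hTn : ∀ n : ℕ, T^[n] (x0, 0) = (t1^[n] x0, 0) := by
    intro n
    induction n with
    | zero => rfl
    | succ k ih =>
      rw [Function.iterate_succ_apply', Function.iterate_succ_apply', ih, hT, ht1]
      simp [hF2, hK2.le]
  simp only [hTn]
  exact hlim.prodMk_nhds tendsto_const_nhds
end

section
/- (Property 5i, appearance of the superstable 2-cycle) Assume τ > 1 and N·(1 − 1/τ) > K̄, where K̄ = (2γ(τ−1)N + sqrt((2γ(τ−1)N)² + 24Nγτ))/(6γτ) (equivalently, F_Δ′(N·(1−1/τ)) < −1). Then there exists ε > 0 such that for every K with N·(1 − 1/τ) < K < N·(1 − 1/τ) + ε: one has 0 < F_Δ(K) < K, T_Δ(K) = F_Δ(K), and T_Δ(F_Δ(K)) = K. Hence {K, F_Δ(K)} is a 2-cycle of T_Δ containing the point K of the flat branch (a superstable 2-cycle), while the fixed point N·(1 − 1/τ)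 is on the decreasing smooth branch. -/
/-- Property 5i, appearance of the superstable 2-cycle: assume `τ > 1`
and `N·(1 − 1/τ) > K̄` (equivalently `F_Δ′(N(1−1/τ)) < −1`). Then for every `K`
slightly larger than the border collision value `N·(1 − 1/τ)` one has
`0 < F_Δ(K) < K`, `T_Δ(K) = F_Δ(K)` and `T_Δ(F_Δ(K)) = K`, so that `{K, F_Δ(K)}` is a
superstable 2-cycle of the diagonal map `T_Δ` (with constraint `K`) containing the
point `K` of the flat branch. -/
theorem segregation_superstable_two_cycle
    (γ τ N : ℝ) (hγ : 0 < γ) (hτ : 1 < τ) (hN : 0 < N)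
    (FΔ : ℝ → ℝ)
    (hFΔ : ∀ x, FΔ x = x * (1 - γ * x + γ * τ * x * (1 - x / N)))
    (TΔ : ℝ → ℝ → ℝ)
    (hTΔ : ∀ K x, TΔ K x = min K (max 0 (FΔ x)))
    (Kbar : ℝ)
    (hKbar : Kbar = (2 * γ * (τ - 1) * N +
      Real.sqrt ((2 * γ * (τ - 1) * N) ^ 2 + 24 * N * γ * τ)) / (6 * γ * τ))
    (hbif : N * (1 - 1 / τ) > Kbar) :
    ∃ ε > (0 : ℝ), ∀ K : ℝ, N * (1 - 1 / τ) < K → K < N * (1 - 1 / τ) + ε →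
      0 < FΔ K ∧ FΔ K < K ∧ TΔ K K = FΔ K ∧ TΔ K (FΔ K) = K := by
  obtain ⟨p, hp⟩ : ∃ p, p = N * (1 - 1 / τ) := ⟨_, rfl⟩
  obtain ⟨c, hc⟩ : ∃ c, c = γ * τ / N := ⟨_, rfl⟩
  rw [← hp] at hbif ⊢
  have hτ0 : 0 < τ := by linarith
  have hc0 : 0 < c := by rw [hc]; positivity
  have hpt : τ * p = N * (τ - 1) := by rw [hp]; field_simp
  have hcN : c * N = γ * τ := by rw [hc]; field_simp
  have hp0 : 0 < p := by
    have : 0 < τ * p := by rw [hpt]; exact mul_pos hN (by linarith)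
    exact pos_of_mul_pos_right this hτ0.le
  have hF : ∀ x, FΔ x = x + c * x ^ 2 * (p - x) := by
    intro x
    rw [hFΔ, hp, hc]
    field_simp
    ring
  have hcp : 2 < c * p ^ 2 := by
    have e : 2 * γ * (τ - 1) * N = 2 * (γ * τ) * p := by linear_combination (-2 * γ) * hpt
    rw [hKbar, e, gt_iff_lt, div_lt_iff₀ (by positivity)] at hbif
    have h1 : Real.sqrt ((2 * (γ * τ) * p) ^ 2 + 24 * N * γ * τ) < 4 * (γ * τ) * p := by
      linarith
    rw [Real.sqrt_lt' (by positivity)] at h1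
    have hg : 0 < γ * τ := by positivity
    have h2 : (γ * τ) * (2 * N) < (γ * τ) * (γ * τ * p ^ 2) := by nlinarith
    have h3 := lt_of_mul_lt_mul_left h2 hg.le
    rw [← hcN] at h3
    have h4 : N * 2 < N * (c * p ^ 2) := by linarith
    exact lt_of_mul_lt_mul_left h4 hN.le
  have ev : ∀ᶠ K in nhds p, 0 < K + c * K ^ 2 * (p - K) ∧
      0 < (K + c * K ^ 2 * (p - K)) ^ 2 * (c * K ^ 2 - 1) - K ^ 2 := by
    refine Filter.Eventually.and ?_ ?_
    · refine (ContinuousAt.eventually_lt (f := fun _ => (0:ℝ)) (by fun_prop) (by fun_prop) ?_)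
      simpa using hp0
    · refine (ContinuousAt.eventually_lt (f := fun _ => (0:ℝ)) (by fun_prop) (by fun_prop) ?_)
      have : 0 < p ^ 2 * (c * p ^ 2 - 2) := mul_pos (by positivity) (by linarith)
      simp only [sub_self, mul_zero, add_zero]
      linarith
  obtain ⟨ε, hε, h⟩ := Metric.eventually_nhds_iff.1 ev
  refine ⟨ε, hε, fun K h1 h2 => ?_⟩
  obtain ⟨ha, hb⟩ := h (y := K) (by rw [Real.dist_eq, abs_lt]; constructor <;> linarith)
  have hK0 : 0 < K := by linarith
  rw [← hF] at ha hb
  have hlt : FΔ K < K := by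
    have : 0 < c * K ^ 2 * (K - p) := mul_pos (by positivity) (by linarith)
    rw [hF]; linarith
  have hge : K ≤ FΔ (FΔ K) := by
    have e : FΔ (FΔ K) - K =
        c * (K - p) * (FΔ K ^ 2 * (c * K ^ 2 - 1) - K ^ 2) := by
      rw [hF (FΔ K)]
      linear_combination (1 - c * FΔ K ^ 2) * hF K
    have : 0 < c * (K - p) * (FΔ K ^ 2 * (c * K ^ 2 - 1) - K ^ 2) :=
      mul_pos (mul_pos hc0 (by linarith)) hb
    linarith
  refine ⟨ha, hlt, ?_, ?_⟩
  · rw [hTΔ, max_eq_right ha.le, min_eq_right hlt.le]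
  · rw [hTΔ, max_eq_right (by linarith), min_eq_left hge]
end

section
/- (Property 5ii, transition from piecewise-smooth to smooth) Let x_c = N(τ−1)/(3τ) + sqrt((N(τ−1)/(3τ))² + N/(3γτ)). Then x_c > 0, F_Δ′(x_c) = 0, and F_Δ(x) ≤ F_Δ(x_c) for all x ≥ 0 (x_c is the global maximum point of F_Δ on the nonnegative half-line). Consequently, if K ≥ F_Δ(x_c), then T_Δ(x) = max(0, F_Δ(x)) for all x ≥ 0, i.e. the flat branch at level K disappears and T_Δ coincides with the map max(0, F_Δ). -/
/-- Property 5ii, transition from piecewise-smooth to smooth: the point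
`x_c = N(τ−1)/(3τ) + sqrt((N(τ−1)/(3τ))² + N/(3γτ))` is positive, is a critical point
of `F_Δ` (`F_Δ′(x_c) = 0`), and is the global maximum point of `F_Δ` on the nonnegative
half-line; consequently, if `K ≥ F_Δ(x_c)` then `T_Δ(x) = max(0, F_Δ(x))` for every
`x ≥ 0`, i.e. the flat branch at level `K` disappears. -/
theorem segregation_flat_branch_disappears
    (γ τ N K : ℝ) (hγ : 0 < γ) (hτ : 0 < τ) (hN : 0 < N) (hK : 0 < K)
    (FΔ FΔ' TΔ : ℝ → ℝ)
    (hFΔ : ∀ x, FΔ x = x * (1 - γ * x + γ * τ * x * (1 - x / N)))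
    (hFΔ' : ∀ x, FΔ' x = 1 + 2 * γ * (τ - 1) * x - 3 * γ * τ * x ^ 2 / N)
    (hTΔ : ∀ x, TΔ x = min K (max 0 (FΔ x)))
    (xc : ℝ)
    (hxc : xc = N * (τ - 1) / (3 * τ) +
      Real.sqrt ((N * (τ - 1) / (3 * τ)) ^ 2 + N / (3 * γ * τ))) :
    0 < xc ∧
    FΔ' xc = 0 ∧
    (∀ x : ℝ, 0 ≤ x → FΔ x ≤ FΔ xc) ∧
    (K ≥ FΔ xc → ∀ x : ℝ, 0 ≤ x → TΔ x = max 0 (FΔ x)) := by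
  have hq : 0 < N / (3 * γ * τ) := by positivity
  have hpa : N * (τ - 1) / (3 * τ) * (3 * (γ * τ / N)) = γ * (τ - 1) := by
    field_simp
  have hqa : N / (3 * γ * τ) * (3 * (γ * τ / N)) = 1 := by
    field_simp
  have ha : 0 < γ * τ / N := by positivity
  generalize N * (τ - 1) / (3 * τ) = p at *
  generalize N / (3 * γ * τ) = q at *
  have hs := Real.sq_sqrt (show 0 ≤ p ^ 2 + q by positivity)
  have hs0 := Real.sqrt_nonneg (p ^ 2 + q)
  generalize Real.sqrt (p ^ 2 + q) = s at *
  have hc : 0 < xc := by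
    rw [hxc]
    by_contra h
    nlinarith
  have hF : ∀ x, FΔ x = x + γ * (τ - 1) * x ^ 2 - γ * τ / N * x ^ 3 := by
    intro x
    rw [hFΔ]
    ring
  have hF' : ∀ x, FΔ' x = 1 + 2 * (γ * (τ - 1)) * x - 3 * (γ * τ / N) * x ^ 2 := by
    intro x
    rw [hFΔ']
    ring
  generalize γ * τ / N = a at *
  generalize γ * (τ - 1) = b at *
  have hcq : xc ^ 2 - 2 * p * xc = q := by
    subst hxc
    linear_combination hs
  have hcrit : 1 + 2 * b * xc - 3 * a * xc ^ 2 = 0 := by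
    linear_combination (-3 * a) * hcq - hqa - 2 * xc * hpa
  have hpos : 0 < 2 * a * xc - b := by
    have h1 : xc * (2 * a * xc - b) = (a * xc ^ 2 + 1) / 2 := by
      linear_combination (-1 / 2) * hcrit
    have h2 : 0 < xc * (2 * a * xc - b) := by
      rw [h1]
      positivity
    exact (pos_iff_pos_of_mul_pos h2).1 hc
  have hmax : ∀ x : ℝ, 0 ≤ x → FΔ x ≤ FΔ xc := by
    intro x hx
    have h : FΔ xc - FΔ x = (x - xc) ^ 2 * (a * x + (2 * a * xc - b)) := by
      rw [hF, hF]
      linear_combination (xc - x) * hcrit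
    have h3 : 0 ≤ (x - xc) ^ 2 * (a * x + (2 * a * xc - b)) := by
      have := hpos.le
      positivity
    linarith
  refine ⟨hc, by rw [hF', hcrit], hmax, fun hKc x hx => ?_⟩
  rw [hTΔ]
  exact min_eq_right (max_le hK.le ((hmax x hx).trans hKc))
end

section
/- (Border collision curves of the corner fixed point) For K1 ∈ (0, N1] and K2 ∈ (0, N2], the corner point P = (K1, K2) is a fixed point of T, i.e. T(K1, K2) = (K1, K2), if and only if K2 ≤ τ1·K1·(1 − K1/N1) and K1 ≤ τ2·K2·(1 − K2/N2). (The equalities K2 = τ1·K1·(1 − K1/N1) and K1 = τ2·K2·(1 − K2/N2) are the border collision bifurcation curves BC_{e,1} and BC_{e,2} bounding the region of existence of the superstable fixed point P in the (K1,K2)-parameter plane.) -/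
/-- Border collision curves of the corner fixed point: the corner point
`P = (K1, K2)` is a fixed point of `T` if and only if `K2 ≤ τ1·K1·(1 − K1/N1)` and
`K1 ≤ τ2·K2·(1 − K2/N2)`; the corresponding equalities are the border collision
bifurcation curves `BC_{e,1}` and `BC_{e,2}` in the `(K1,K2)`-parameter plane. -/
theorem segregation_corner_fixed_point_region
    (γ1 γ2 τ1 τ2 N1 N2 K1 K2 : ℝ)
    (hγ1 : 0 < γ1) (hγ2 : 0 < γ2) (hτ1 : 0 < τ1) (hτ2 : 0 < τ2)
    (hN1 : 0 < N1) (hN2 : 0 < N2)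
    (hK1 : 0 < K1) (hK1N : K1 ≤ N1) (hK2 : 0 < K2) (hK2N : K2 ≤ N2)
    (F1 F2 : ℝ → ℝ → ℝ)
    (hF1 : ∀ x1 x2, F1 x1 x2 = x1 * (1 - γ1 * x2 + γ1 * τ1 * x1 * (1 - x1 / N1)))
    (hF2 : ∀ x1 x2, F2 x1 x2 = x2 * (1 - γ2 * x1 + γ2 * τ2 * x2 * (1 - x2 / N2)))
    (T : ℝ × ℝ → ℝ × ℝ)
    (hT : ∀ p : ℝ × ℝ, T p = (min K1 (max 0 (F1 p.1 p.2)), min K2 (max 0 (F2 p.1 p.2)))) :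
    T (K1, K2) = (K1, K2) ↔
      (K2 ≤ τ1 * K1 * (1 - K1 / N1) ∧ K1 ≤ τ2 * K2 * (1 - K2 / N2)) := by
  have key : ∀ g t N a b : ℝ, 0 < g → 0 < a →
      (min a (max 0 (a * (1 - g * b + g * t * a * (1 - a / N)))) = a ↔
        b ≤ t * a * (1 - a / N)) := by
    intro g t N a b hg ha
    have e : a * (1 - g * b + g * t * a * (1 - a / N))
        = a + a * g * (t * a * (1 - a / N) - b) := by ring
    have hag : 0 < a * g := mul_pos ha hg
    rw [e, min_eq_left_iff, le_max_iff]
    constructor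
    · rintro (h | h)
      · linarith
      · have h2 : 0 ≤ a * g * (t * a * (1 - a / N) - b) := by linarith
        have h3 := nonneg_of_mul_nonneg_right h2 hag
        linarith
    · intro h
      right
      have := mul_nonneg hag.le (sub_nonneg.mpr h)
      linarith
  rw [hT, Prod.mk.injEq]
  simp only [hF1, hF2]
  rw [key γ1 τ1 N1 K1 K2 hγ1 hK1, key γ2 τ2 N2 K2 K1 hγ2 hK2]
end

section
/- (Maximum of the restriction to the line x1 = K1) Assume γ2·K1 ≤ 1 and set x*_{2,c} = N2/3 + sqrt((N2/3)² + N2·(1 − γ2·K1)/(3·γ2·τ2)). Then the derivative of the map x2 ↦ F2(K1, x2) vanishes at x*_{2,c}, and for every x2 ≥ 0 one has F2(K1, x2) ≤ F2(K1, x*_{2,c}) = γ2·τ2·(x*_{2,c})²·(2·x*_{2,c}/N2 − 1); that is, x*_{2,c} is the global maximum point of x2 ↦ F2(K1, x2) on the nonnegative half-line and its maximal value equals γ2·τ2·(x*_{2,c})²·(2·x*_{2,c}/N2 − 1). (The condition K2 = γ2·τ2·(x*_{2,c})²·(2·x*_{2,c}/N2 − 1) defines the border collision bifurcation curve BC_{p,2}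 in the (K1,K2)-parameter plane.) -/
/-- Maximum of the restriction to the line `x1 = K1`: if `γ2·K1 ≤ 1`,
then at `x*_{2,c} = N2/3 + sqrt((N2/3)² + N2·(1 − γ2·K1)/(3·γ2·τ2))` the derivative of
`x2 ↦ F2(K1, x2)` vanishes, `x*_{2,c}` is the global maximum point of this map on the
nonnegative half-line, and the maximal value equals
`γ2·τ2·(x*_{2,c})²·(2·x*_{2,c}/N2 − 1)` (the value defining the BCB curve `BC_{p,2}`). -/
theorem segregation_maximum_of_restriction
    (γ2 τ2 N2 K1 : ℝ)
    (hγ2 : 0 < γ2) (hτ2 : 0 < τ2) (hN2 : 0 < N2) (hK1 : 0 < K1)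
    (hsmall : γ2 * K1 ≤ 1)
    (F2 : ℝ → ℝ → ℝ)
    (hF2 : ∀ x1 x2, F2 x1 x2 = x2 * (1 - γ2 * x1 + γ2 * τ2 * x2 * (1 - x2 / N2)))
    (x2c : ℝ)
    (hx2c : x2c = N2 / 3 +
      Real.sqrt ((N2 / 3) ^ 2 + N2 * (1 - γ2 * K1) / (3 * γ2 * τ2))) :
    HasDerivAt (fun x2 => F2 K1 x2) 0 x2c ∧
    (∀ x2 : ℝ, 0 ≤ x2 → F2 K1 x2 ≤ F2 K1 x2c) ∧
    F2 K1 x2c = γ2 * τ2 * x2c ^ 2 * (2 * x2c / N2 - 1) := by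
  have hb : 0 < γ2 * τ2 := mul_pos hγ2 hτ2
  have hnn : 0 ≤ N2 * (1 - γ2 * K1) / (3 * γ2 * τ2) :=
    div_nonneg (mul_nonneg hN2.le (by linarith)) (by positivity)
  have hsq := Real.sq_sqrt (add_nonneg (sq_nonneg (N2 / 3)) hnn)
  have hge : N2 / 3 ≤ Real.sqrt ((N2 / 3) ^ 2 + N2 * (1 - γ2 * K1) / (3 * γ2 * τ2)) :=
    Real.le_sqrt_of_sq_le (by linarith)
  rw [show Real.sqrt ((N2 / 3) ^ 2 + N2 * (1 - γ2 * K1) / (3 * γ2 * τ2)) = x2c - N2 / 3 by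
    linarith] at hsq hge
  have h1 : N2 * (1 - γ2 * K1) / (3 * γ2 * τ2) = x2c ^ 2 - 2 * N2 / 3 * x2c := by linarith
  rw [div_eq_iff (by positivity)] at h1
  have ha : 1 - γ2 * K1 = 3 * (γ2 * τ2) * x2c ^ 2 / N2 - 2 * (γ2 * τ2) * x2c := by
    field_simp
    linarith
  have hF : ∀ x, F2 K1 x = x * (3 * (γ2 * τ2) * x2c ^ 2 / N2 - 2 * (γ2 * τ2) * x2c
      + γ2 * τ2 * x * (1 - x / N2)) := by
    intro x
    rw [hF2, ha]
  refine ⟨?_, ?_, ?_⟩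
  · have hfun : (fun x2 => F2 K1 x2) = fun x =>
        (3 * (γ2 * τ2) * x2c ^ 2 / N2 - 2 * (γ2 * τ2) * x2c) * x
        + (γ2 * τ2) * x ^ 2 - (γ2 * τ2 / N2) * x ^ 3 := by
      funext x
      rw [hF]
      ring
    rw [hfun]
    have hd := (((hasDerivAt_id' x2c).const_mul
        (3 * (γ2 * τ2) * x2c ^ 2 / N2 - 2 * (γ2 * τ2) * x2c)).add
        ((hasDerivAt_pow 2 x2c).const_mul (γ2 * τ2))).sub
        ((hasDerivAt_pow 3 x2c).const_mul (γ2 * τ2 / N2))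
    refine hd.congr_deriv ?_
    push_cast
    ring
  · intro x hx
    have key : F2 K1 x2c - F2 K1 x
        = (γ2 * τ2 / N2) * (x - x2c) ^ 2 * (x + 2 * x2c - N2) := by
      rw [hF, hF]
      field_simp
      ring
    have h3 : 0 ≤ x + 2 * x2c - N2 := by linarith
    have : 0 ≤ (γ2 * τ2 / N2) * (x - x2c) ^ 2 * (x + 2 * x2c - N2) := by positivity
    linarith
  · rw [hF]
    ring
end
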